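/- arXiv:2205.09739 — 5 statements merged into one kernel-verified Lean document; each statement's English description precedes it below -/
import Mathlib

section
/- Let E be a real inner product space, U ⊆ E an open convex set, and f : E → ℝ twice continuously differentiable on U with the operator norm of its second derivative bounded by C ≥ 0 at every point of U. Let θ_1, …, θ_M ∈ U (M ≥ 1), let θ_WA = (1/M) ∑_{m=1}^M θ_m (which lies in U by convexity), and let Δ = max_{1 ≤ m ≤ M} ‖θ_m − θ_WA‖. Then |(1/M) ∑_{m=1}^M f(θ_m) − f(θ_WA)| ≤ (C/2) Δ², i.e., the prediction of the weight-averaged model equals the averaged prediction of the individual models up to an error of order Δ². -/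
open Set in
/-- First-order Taylor estimate on an open convex set: if the second derivative of `f` is bounded
by `C`, the linearization of `f` at `x` is accurate up to `C / 2 * ‖y - x‖ ^ 2`. -/
theorem Convex.norm_sub_sub_fderivWithin_le {E F : Type*} [NormedAddCommGroup E] [NormedSpace ℝ E]
    [NormedAddCommGroup F] [NormedSpace ℝ F] {U : Set E} {f : E → F} {C : ℝ} {x y : E}
    (hUconv : Convex ℝ U) (hUopen : IsOpen U) (hf : ContDiffOn ℝ 2 f U)
    (hC : ∀ z ∈ U, ‖iteratedFDerivWithin ℝ 2 f U z‖ ≤ C) (hx : x ∈ U) (hy : y ∈ U) :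
    ‖f y - f x - fderivWithin ℝ f U x (y - x)‖ ≤ C / 2 * ‖y - x‖ ^ 2 := by
  have hU : UniqueDiffOn ℝ U := hUopen.uniqueDiffOn
  have hdiff : DifferentiableOn ℝ (fderivWithin ℝ f U) U :=
    (hf.fderivWithin hU (m := 1) (by norm_num)).differentiableOn (by norm_num)
  have hbound : ∀ z ∈ U, ‖fderivWithin ℝ (fderivWithin ℝ f U) U z‖ ≤ C := fun z hz ↦ by
    rw [← norm_iteratedFDerivWithin_one _ (hU z hz),
      norm_iteratedFDerivWithin_fderivWithin hU hz]
    exact hC z hz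
  have hmem : ∀ t ∈ Icc (0 : ℝ) 1, x + t • (y - x) ∈ U := fun t ht ↦
    hUconv.add_smul_sub_mem hx hy ht
  have hderiv : ∀ t ∈ Icc (0 : ℝ) 1,
      HasDerivAt (fun s : ℝ ↦ f (x + s • (y - x)) - f x - s • fderivWithin ℝ f U x (y - x))
        (fderivWithin ℝ f U (x + t • (y - x)) (y - x) - fderivWithin ℝ f U x (y - x)) t := by
    intro t ht
    have hline : HasDerivAt (fun s : ℝ ↦ x + s • (y - x)) (y - x) t := by
      simpa using ((hasDerivAt_id t).smul_const (y - x)).const_add x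
    have hfd : HasFDerivAt f (fderivWithin ℝ f U (x + t • (y - x))) (x + t • (y - x)) :=
      ((hf.differentiableOn (by norm_num)) _ (hmem t ht)).hasFDerivWithinAt.hasFDerivAt
        (hUopen.mem_nhds (hmem t ht))
    have hlin : HasDerivAt (fun s : ℝ ↦ s • fderivWithin ℝ f U x (y - x))
        (fderivWithin ℝ f U x (y - x)) t := by
      simpa using (hasDerivAt_id t).smul_const (fderivWithin ℝ f U x (y - x))
    exact ((hfd.comp_hasDerivAt t hline).sub_const (f x)).sub hlin
  have hB : ∀ t : ℝ, HasDerivAt (fun s : ℝ ↦ C / 2 * ‖y - x‖ ^ 2 * s ^ 2)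
      (C * ‖y - x‖ ^ 2 * t) t := fun t ↦
    ((hasDerivAt_pow 2 t).const_mul (C / 2 * ‖y - x‖ ^ 2)).congr_deriv (by push_cast; ring)
  have key := image_norm_le_of_norm_deriv_right_le_deriv_boundary
    (fun t ht ↦ (hderiv t ht).continuousAt.continuousWithinAt)
    (fun t ht ↦ (hderiv t (Ico_subset_Icc_self ht)).hasDerivWithinAt) (by simp) hB
    (fun t ht ↦ ?_) (right_mem_Icc.2 (zero_le_one' ℝ))
  · simpa using key
  · rw [← sub_apply]
    have hle := hUconv.norm_image_sub_le_of_norm_fderivWithin_le hdiff hbound hx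
      (hmem t (Ico_subset_Icc_self ht))
    rw [add_sub_cancel_left, norm_smul, Real.norm_of_nonneg ht.1] at hle
    calc _ ≤ C * (t * ‖y - x‖) * ‖y - x‖ := ContinuousLinearMap.le_of_opNorm_le _ hle _
      _ = _ := by ring


/-- Quantitative functional approximation (paper's Lemma 1, functional part):
the prediction of the weight-averaged model equals the averaged prediction of
the individual models up to an error of order `Δ²`. -/
theorem wa_approximates_ens {E : Type*} [NormedAddCommGroup E] [InnerProductSpace ℝ E]
    (U : Set E) (hUopen : IsOpen U) (hUconv : Convex ℝ U)
    (f : E → ℝ) (C : ℝ) (hC : 0 ≤ C)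
    (hf : ContDiffOn ℝ 2 f U)
    (hf'' : ∀ x ∈ U, ‖iteratedFDerivWithin ℝ 2 f U x‖ ≤ C)
    (M : ℕ) (hM : 1 ≤ M)
    (θ : Fin M → E) (hθ : ∀ m, θ m ∈ U)
    (θWA : E) (hθWA : θWA = (M : ℝ)⁻¹ • ∑ m, θ m)
    (Δ : ℝ) (hΔ : Δ = ⨆ m, ‖θ m - θWA‖) :
    |(M : ℝ)⁻¹ * (∑ m, f (θ m)) - f θWA| ≤ C / 2 * Δ ^ 2 := by
  have : NeZero M := ⟨by omega⟩
  have hM0 : (M : ℝ) ≠ 0 := NeZero.ne _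
  have hWA : θWA ∈ U := by
    rw [hθWA, Finset.smul_sum]
    exact hUconv.sum_mem (fun _ _ ↦ by positivity) (by simp [hM0]) (fun m _ ↦ hθ m)
  have hle : ∀ m, ‖θ m - θWA‖ ≤ Δ := fun m ↦
    hΔ ▸ le_ciSup (f := fun m ↦ ‖θ m - θWA‖) (Set.finite_range _).bddAbove m
  have hsum : ∑ m, (θ m - θWA) = 0 := by
    simp [hθWA, ← Nat.cast_smul_eq_nsmul ℝ, smul_smul, hM0]
  have hlin : ∑ m, fderivWithin ℝ f U θWA (θ m - θWA) = 0 := by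
    rw [← map_sum, hsum, map_zero]
  have heq : (M : ℝ)⁻¹ * (∑ m, f (θ m)) - f θWA =
      (M : ℝ)⁻¹ * ∑ m, (f (θ m) - f θWA - fderivWithin ℝ f U θWA (θ m - θWA)) := by
    rw [Finset.sum_sub_distrib, hlin, Finset.sum_sub_distrib]
    simp [mul_sub, hM0]
  rw [heq, abs_mul, abs_of_nonneg (by positivity : (0 : ℝ) ≤ (M : ℝ)⁻¹)]
  calc _ ≤ (M : ℝ)⁻¹ * ∑ _m : Fin M, C / 2 * Δ ^ 2 := by
        gcongr
        refine (Finset.abs_sum_le_sum_abs _ _).trans (Finset.sum_le_sum fun m _ ↦ ?_)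
        refine (hUconv.norm_sub_sub_fderivWithin_le hUopen hf hf'' hWA (hθ m)).trans ?_
        gcongr
        exact hle m
    _ = _ := by simp [hM0]
end

section
/- Let 𝒳 be a measurable space, μ a probability measure on 𝒳, A ⊆ 𝒳 a measurable set, and f_T, f_S, g : 𝒳 → ℝ measurable functions with (f_T − g)² μ-integrable. Assume there exist ε ≥ 0 and K ≥ 0 such that |f_S(x) − g(x)| ≤ ε for all x ∈ A and |f_T(x) − f_S(x)| ≤ K for all x ∈ A. Then | ∫_𝒳 (f_T − g)² dμ − ( ∫_A (f_T − f_S)² dμ + ∫_{𝒳∖A} (f_T − g)² dμ ) | ≤ ε² + 2Kε. In the paper's terminology: under the small-IID-bias assumption, the expected out-of-distribution squared bias equals the correlation-shift term ∫_{𝒳_T∩𝒳_S}(f_T − f_S)² p_T plus the support-mismatch term ∫_{𝒳_T∖𝒳_S}(f_T − f̄_S)² p_T, up to an error of order ε. -/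
open MeasureTheory

/-- Quantitative form of the paper's Proposition 2 (OOD bias and correlation
shift): under the small-IID-bias assumption `|f_S − f̄_S| ≤ ε` on the source
support and bounded difference of labeling functions, the OOD squared bias
equals the correlation-shift term plus the support-mismatch term up to an error
of order `ε`. -/
theorem ood_bias_correlation_shift {X : Type*} [MeasurableSpace X]
    (μ : Measure X) [IsProbabilityMeasure μ]
    (A : Set X) (hA : MeasurableSet A)
    (fT fS g : X → ℝ)
    (hfT : Measurable fT) (hfS : Measurable fS) (hg : Measurable g)
    (h1 : Integrable (fun x => (fT x - g x) ^ 2) μ)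
    (ε K : ℝ) (hε : 0 ≤ ε) (hK : 0 ≤ K)
    (hIID : ∀ x ∈ A, |fS x - g x| ≤ ε)
    (hbdd : ∀ x ∈ A, |fT x - fS x| ≤ K) :
    |(∫ x, (fT x - g x) ^ 2 ∂μ) -
        ((∫ x in A, (fT x - fS x) ^ 2 ∂μ) +
          ∫ x in Aᶜ, (fT x - g x) ^ 2 ∂μ)| ≤ ε ^ 2 + 2 * K * ε := by
  have hS : IntegrableOn (fun x => (fT x - fS x) ^ 2) A μ := by
    refine Measure.integrableOn_of_bounded (M := K ^ 2) (measure_ne_top μ A)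
      ((hfT.sub hfS).pow_const 2).aestronglyMeasurable ?_
    filter_upwards [ae_restrict_mem hA] with x hx
    rw [Real.norm_eq_abs, abs_pow]
    exact pow_le_pow_left₀ (abs_nonneg _) (hbdd x hx) 2
  have hpointwise : ∀ x ∈ A,
      ‖(fT x - g x) ^ 2 - (fT x - fS x) ^ 2‖ ≤ ε ^ 2 + 2 * K * ε := by
    intro x hx
    have hsq : |fS x - g x| ^ 2 ≤ ε ^ 2 :=
      pow_le_pow_left₀ (abs_nonneg _) (hIID x hx) 2
    have hmul : |fT x - fS x| * |fS x - g x| ≤ K * ε :=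
      mul_le_mul (hbdd x hx) (hIID x hx) (abs_nonneg _) hK
    calc ‖(fT x - g x) ^ 2 - (fT x - fS x) ^ 2‖
        = |(fS x - g x) ^ 2 + 2 * ((fT x - fS x) * (fS x - g x))| := by
          rw [Real.norm_eq_abs]
          ring_nf
      _ ≤ |fS x - g x| ^ 2 + 2 * (|fT x - fS x| * |fS x - g x|) := by
          refine (abs_add_le _ _).trans_eq ?_
          rw [abs_pow, abs_mul, abs_mul, abs_two]
      _ ≤ ε ^ 2 + 2 * K * ε := by linarith
  rw [← integral_add_compl hA h1, add_sub_add_right_eq_sub,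
    ← integral_sub h1.integrableOn hS, ← Real.norm_eq_abs]
  calc _ ≤ (ε ^ 2 + 2 * K * ε) * μ.real A :=
        norm_setIntegral_le_of_norm_le_const (measure_lt_top μ A) hpointwise
    _ ≤ ε ^ 2 + 2 * K * ε :=
        mul_le_of_le_one_right (by positivity) measureReal_le_one
end

section
/- Let 𝒳 be a measurable space, μ a probability measure on 𝒳, A ⊆ 𝒳 a measurable set, and f_T, f_S, g : 𝒳 → ℝ measurable functions with (f_T − g)² μ-integrable and (f_T − f_S)² μ-integrable on A. Assume there exists ε ≥ 0 such that |f_S(x) − g(x)| ≤ ε for all x ∈ A. Then ∫_𝒳 (f_T − g)² dμ ≤ 2 ∫_A (f_T − f_S)² dμ + ∫_{𝒳∖A} (f_T − g)² dμ + 2ε². In the paper's terminology: without assuming bounded difference between labeling functions, the out-of-distribution squared bias is at most twice the correlation-shift term plus the support-mismatch term plus 2ε². -/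
open MeasureTheory

/-- Paper's Proposition (OOD bias when small IID bias, without bounded
difference between labeling functions): the OOD squared bias is at most twice
the correlation-shift term plus the support-mismatch term plus `2ε²`. -/
theorem ood_bias_upper_bound {X : Type*} [MeasurableSpace X]
    (μ : Measure X) [IsProbabilityMeasure μ]
    (A : Set X) (hA : MeasurableSet A)
    (fT fS g : X → ℝ)
    (hfT : Measurable fT) (hfS : Measurable fS) (hg : Measurable g)
    (h1 : Integrable (fun x => (fT x - g x) ^ 2) μ)
    (h2 : IntegrableOn (fun x => (fT x - fS x) ^ 2) A μ)
    (ε : ℝ) (hε : 0 ≤ ε)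
    (hIID : ∀ x ∈ A, |fS x - g x| ≤ ε) :
    ∫ x, (fT x - g x) ^ 2 ∂μ ≤
      2 * (∫ x in A, (fT x - fS x) ^ 2 ∂μ) +
        (∫ x in Aᶜ, (fT x - g x) ^ 2 ∂μ) + 2 * ε ^ 2 := by
  have hbound : ∀ x ∈ A, (fT x - g x) ^ 2 ≤ 2 * (fT x - fS x) ^ 2 + 2 * ε ^ 2 := by
    intro x hx
    have hsq : (fS x - g x) ^ 2 ≤ ε ^ 2 := sq_le_sq' (abs_le.mp (hIID x hx)).1
      (abs_le.mp (hIID x hx)).2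
    nlinarith [sq_nonneg ((fT x - fS x) - (fS x - g x))]
  have hconst : IntegrableOn (fun _ : X => 2 * ε ^ 2) A μ := integrable_const _
  have hA_le : ∫ x in A, (fT x - g x) ^ 2 ∂μ ≤
      2 * (∫ x in A, (fT x - fS x) ^ 2 ∂μ) + μ.real A * (2 * ε ^ 2) := by
    calc ∫ x in A, (fT x - g x) ^ 2 ∂μ
        ≤ ∫ x in A, (2 * (fT x - fS x) ^ 2 + 2 * ε ^ 2) ∂μ :=
          setIntegral_mono_on h1.integrableOn (Integrable.fun_add (h2.const_mul 2) hconst) hA hbound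
      _ = _ := by
          rw [integral_add (h2.const_mul 2) hconst, integral_const_mul, setIntegral_const,
            smul_eq_mul]
  have hmass : μ.real A * (2 * ε ^ 2) ≤ 2 * ε ^ 2 :=
    mul_le_of_le_one_left (by positivity) measureReal_le_one
  rw [← integral_add_compl hA h1]
  linarith
end

section
/- Let 𝒳 be a type, S and T finite subsets of 𝒳 with cardinalities n_S ≥ 2 and n_T ≥ 2, and K : 𝒳 × 𝒳 → ℝ a symmetric function. Assume there exists λ_S > 0 with K(s,s) = λ_S for all s ∈ S and K(s,s′) = 0 for all distinct s, s′ ∈ S. Define var(t) = K(t,t) − (1/λ_S) ∑_{s∈S} K(t,s)² for t ∈ T; λ_T = (1/n_T) ∑_{t∈T} K(t,t); β_T = (1/(n_T(n_T−1))) ∑_{t≠t′∈T} K(t,t′)²; and the empirical squared Maximum Mean Discrepancy with kernel K²: MMD² = (1/(n_S(n_S−1))) ∑_{s≠s′∈S} K(s,s′)² + (1/(n_T(n_T−1))) ∑_{t≠t′∈T} K(t,t′)² − (2/(n_S n_T)) ∑_{s∈S, t∈T} K(s,t)². Then (1/n_T) ∑_{t∈T} var(t) = (n_S/(2λ_S))·MMD²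 + λ_T − (n_S/(2λ_S))·β_T. -/
/-- Exact (ε = 0) case of the paper's Proposition 3 (OOD variance and
diversity shift): when the source Gram matrix is `λ_S` times the identity, the
average Gaussian-process posterior variance on the target inputs equals
`(n_S/(2λ_S))·MMD² + λ_T − (n_S/(2λ_S))·β_T`, where `MMD²` is the empirical
squared Maximum Mean Discrepancy between source and target with kernel `K²`. -/
theorem ood_variance_diversity_shift_exact {X : Type*} [DecidableEq X]
    (S T : Finset X) (hS : 2 ≤ S.card) (hT : 2 ≤ T.card)
    (K : X → X → ℝ) (hsym : ∀ a b, K a b = K b a)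
    (lamS : ℝ) (hlamS : 0 < lamS)
    (hdiag : ∀ s ∈ S, K s s = lamS)
    (hoff : ∀ s ∈ S, ∀ s' ∈ S, s ≠ s' → K s s' = 0) :
    (T.card : ℝ)⁻¹ * ∑ t ∈ T, (K t t - lamS⁻¹ * ∑ s ∈ S, K t s ^ 2) =
      (S.card : ℝ) / (2 * lamS) *
          ((1 / ((S.card : ℝ) * ((S.card : ℝ) - 1))) *
              (∑ s ∈ S, ∑ s' ∈ S.erase s, K s s' ^ 2) +
            (1 / ((T.card : ℝ) * ((T.card : ℝ) - 1))) *
              (∑ t ∈ T, ∑ t' ∈ T.erase t, K t t' ^ 2) -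
            2 / ((S.card : ℝ) * (T.card : ℝ)) *
              ∑ s ∈ S, ∑ t ∈ T, K s t ^ 2) +
        (T.card : ℝ)⁻¹ * (∑ t ∈ T, K t t) -
        (S.card : ℝ) / (2 * lamS) *
          ((1 / ((T.card : ℝ) * ((T.card : ℝ) - 1))) *
            ∑ t ∈ T, ∑ t' ∈ T.erase t, K t t' ^ 2) := by
  have hSpos : (S.card : ℝ) ≠ 0 := by
    exact_mod_cast (by omega : S.card ≠ 0)
  have hTpos : (T.card : ℝ) ≠ 0 := by
    exact_mod_cast (by omega : T.card ≠ 0)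
  have hsource : ∑ s ∈ S, ∑ s' ∈ S.erase s, K s s' ^ 2 = 0 := by
    refine Finset.sum_eq_zero fun s hs => Finset.sum_eq_zero fun s' hs' => ?_
    obtain ⟨hne, hmem⟩ := Finset.mem_erase.mp hs'
    rw [hoff s hs s' hmem hne.symm, zero_pow two_ne_zero]
  have hcross : ∑ t ∈ T, ∑ s ∈ S, K t s ^ 2 = ∑ s ∈ S, ∑ t ∈ T, K s t ^ 2 := by
    rw [Finset.sum_comm]
    exact Finset.sum_congr rfl fun s _ => Finset.sum_congr rfl fun t _ => by rw [hsym t s]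
  rw [hsource, Finset.sum_sub_distrib, ← Finset.mul_sum, hcross]
  generalize 1 / ((T.card : ℝ) * ((T.card : ℝ) - 1)) *
    (∑ t ∈ T, ∑ t' ∈ T.erase t, K t t' ^ 2) = betaT
  field_simp
  ring
end

section
/- Let 𝒳 be a type, S and T finite subsets of 𝒳 with cardinalities n_S ≥ 2 and n_T ≥ 2, and K : 𝒳 × 𝒳 → ℝ a symmetric function. Assume there exist λ > 0, ε ≥ 0 and κ ≥ 0 with: K(s,s) = λ for all s ∈ S; |K(s,s′)| ≤ ε for all distinct s, s′ ∈ S; |K(t,s)| ≤ κ for all t ∈ T, s ∈ S; and n_S·ε < λ. Then the Gram matrix K_SS = (K(s,s′))_{s,s′∈S} is invertible, and with var(t) = K(t,t) − k_tᵀ K_SS^{-1} k_t (where k_t = (K(t,s))_{s∈S}), λ_T = (1/n_T) ∑_{t∈T} K(t,t), β_T = (1/(n_T(n_T−1))) ∑_{t≠t′∈T} K(t,t′)², and MMD² = (1/(n_S(n_S−1))) ∑_{s≠s′∈S} K(s,s′)² + β_T − (2/(n_S n_T)) ∑_{s∈S,t∈T} K(s,t)², one has | (1/n_T) ∑_{t∈T}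 var(t) − ( (n_S/(2λ))·MMD² + λ_T − (n_S/(2λ))·β_T ) | ≤ n_S² κ² ε / (λ(λ − n_S ε)) + (n_S/(2λ)) ε². -/
/-- The Gram matrix of a kernel `K` on a finite set `S` of inputs. -/
noncomputable def gramMatrix {X : Type*} (S : Finset X) (K : X → X → ℝ) :
    Matrix {x // x ∈ S} {x // x ∈ S} ℝ :=
  Matrix.of fun i j => K i.1 j.1

/-- A real matrix with constant diagonal `a` and off-diagonal entries bounded by `e` is invertible
when `card ι * e < a`. -/
theorem Matrix.isUnit_det_of_diag_eq_of_abs_offDiag_le {ι : Type*} [Fintype ι] [DecidableEq ι]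
    {G : Matrix ι ι ℝ} {a e : ℝ} (ha : 0 < a) (he : 0 ≤ e) (hdiag : ∀ i, G i i = a)
    (hoff : ∀ i j, i ≠ j → |G i j| ≤ e) (hsmall : (Fintype.card ι : ℝ) * e < a) :
    IsUnit G.det := by
  refine isUnit_iff_ne_zero.mpr (det_ne_zero_of_sum_row_lt_diag fun k => ?_)
  rw [hdiag, Real.norm_of_nonneg ha.le]
  refine lt_of_le_of_lt ?_ hsmall
  calc ∑ j ∈ Finset.univ.erase k, ‖G k j‖
      ≤ ∑ j ∈ Finset.univ.erase k, e :=
        Finset.sum_le_sum fun j hj => hoff k j (Finset.ne_of_mem_erase hj).symm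
    _ ≤ ∑ _j : ι, e :=
        Finset.sum_le_sum_of_subset_of_nonneg (Finset.erase_subset _ _) fun _ _ _ => he
    _ = (Fintype.card ι : ℝ) * e := by simp

/-- Entrywise bounds on a matrix and two vectors bound the entries of the matrix-vector product. -/
theorem Matrix.abs_mulVec_le {ι : Type*} [Fintype ι] {H : Matrix ι ι ℝ} {e : ℝ}
    (hH : ∀ i j, |H i j| ≤ e) (x : ι → ℝ) (i : ι) :
    |(H.mulVec x) i| ≤ (Fintype.card ι : ℝ) * e * ‖x‖ := by
  calc |(H.mulVec x) i| ≤ ∑ j, |H i j * x j| := Finset.abs_sum_le_sum_abs _ _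
    _ ≤ ∑ _j : ι, e * ‖x‖ := by
        refine Finset.sum_le_sum fun j _ => ?_
        rw [abs_mul]
        exact mul_le_mul (hH i j) (norm_le_pi_norm x j) (abs_nonneg _)
          ((abs_nonneg _).trans (hH i j))
    _ = (Fintype.card ι : ℝ) * e * ‖x‖ := by simp [mul_assoc]

/-- The quadratic form of the inverse of a matrix close to `a • 1` is close to that of `a⁻¹ • 1`. -/
theorem Matrix.abs_quadForm_inv_sub_le {ι : Type*} [Fintype ι] [DecidableEq ι]
    {G : Matrix ι ι ℝ} {a e k : ℝ} (ha : 0 < a) (he : 0 ≤ e) (hk : 0 ≤ k)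
    (hdiag : ∀ i, G i i = a) (hoff : ∀ i j, i ≠ j → |G i j| ≤ e)
    (hsmall : (Fintype.card ι : ℝ) * e < a) {v : ι → ℝ} (hv : ∀ i, |v i| ≤ k) :
    |a⁻¹ * ∑ i, v i ^ 2 - ∑ i, ∑ j, v i * G⁻¹ i j * v j| ≤
      (Fintype.card ι : ℝ) ^ 2 * k ^ 2 * e / (a * (a - (Fintype.card ι : ℝ) * e)) := by
  have hG := isUnit_det_of_diag_eq_of_abs_offDiag_le ha he hdiag hoff hsmall
  set n : ℝ := (Fintype.card ι : ℝ) with hn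
  have hn0 : 0 ≤ n := Nat.cast_nonneg _
  set x : ι → ℝ := G⁻¹.mulVec v with hx
  set H : Matrix ι ι ℝ := G - a • 1 with hHdef
  have hH : ∀ i j, |H i j| ≤ e := by
    intro i j
    by_cases hij : i = j
    · subst hij
      simpa [hHdef, hdiag] using he
    · simpa [hHdef, hij] using hoff i j hij
  have hGx : G.mulVec x = v := by
    rw [hx, mulVec_mulVec, mul_nonsing_inv _ hG, one_mulVec]
  have hHx : ∀ i, H.mulVec x i = v i - a * x i := by
    intro i
    rw [hHdef, sub_mulVec, hGx, smul_mulVec, one_mulVec]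
    simp
  have hpos : 0 < a - n * e := sub_pos.mpr hsmall
  have hxnorm : ‖x‖ ≤ k / (a - n * e) := by
    have hbound : ‖x‖ ≤ (k + n * e * ‖x‖) / a := by
      refine (pi_norm_le_iff_of_nonneg (by positivity)).mpr fun i => ?_
      rw [le_div_iff₀ ha, Real.norm_eq_abs, ← abs_of_pos ha, ← abs_mul]
      have : x i * a = v i - H.mulVec x i := by rw [hHx]; ring
      rw [this]
      exact (abs_sub _ _).trans (add_le_add (hv i) (abs_mulVec_le hH x i))
    rw [le_div_iff₀ ha] at hbound
    rw [le_div_iff₀ hpos]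
    linarith
  have hkey : a⁻¹ * ∑ i, v i ^ 2 - ∑ i, ∑ j, v i * G⁻¹ i j * v j =
      a⁻¹ * ∑ i, v i * H.mulVec x i := by
    have hquad : ∑ i, ∑ j, v i * G⁻¹ i j * v j = ∑ i, v i * x i :=
      Finset.sum_congr rfl fun i _ => by
        simp [hx, mulVec, dotProduct, Finset.mul_sum, mul_assoc]
    rw [hquad, Finset.mul_sum, Finset.mul_sum, ← Finset.sum_sub_distrib]
    refine Finset.sum_congr rfl fun i _ => ?_
    rw [hHx]
    field_simp
  have hsum : |∑ i, v i * H.mulVec x i| ≤ n * (k * (n * e * (k / (a - n * e)))) := by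
    calc |∑ i, v i * H.mulVec x i| ≤ ∑ i, |v i * H.mulVec x i| := Finset.abs_sum_le_sum_abs _ _
      _ ≤ ∑ _i : ι, k * (n * e * (k / (a - n * e))) := by
          refine Finset.sum_le_sum fun i _ => ?_
          rw [abs_mul]
          refine mul_le_mul (hv i) ((abs_mulVec_le hH x i).trans ?_) (abs_nonneg _) hk
          gcongr
      _ = n * (k * (n * e * (k / (a - n * e)))) := by simp [hn]
  rw [hkey, abs_mul, abs_of_pos (inv_pos.mpr ha)]
  calc a⁻¹ * |∑ i, v i * H.mulVec x i|
      ≤ a⁻¹ * (n * (k * (n * e * (k / (a - n * e))))) := by gcongr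
    _ = n ^ 2 * k ^ 2 * e / (a * (a - n * e)) := by
        field_simp

/-- The average of a family bounded by `B` in absolute value is bounded by `B`. -/
theorem Finset.abs_inv_card_mul_sum_le {α : Type*} {T : Finset α} (hT : T.Nonempty) {f : α → ℝ}
    {B : ℝ} (hf : ∀ t ∈ T, |f t| ≤ B) : |(T.card : ℝ)⁻¹ * ∑ t ∈ T, f t| ≤ B := by
  have hc : (0 : ℝ) < T.card := by exact_mod_cast hT.card_pos
  rw [abs_mul, abs_of_pos (inv_pos.mpr hc), inv_mul_le_iff₀ hc]
  calc |∑ t ∈ T, f t| ≤ ∑ t ∈ T, |f t| := Finset.abs_sum_le_sum_abs _ _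
    _ ≤ ∑ _t ∈ T, B := Finset.sum_le_sum hf
    _ = T.card * B := by simp

/-- The average over ordered pairs of distinct points of a function with values in `[0, B]`
lies in `[0, B]`. -/
theorem Finset.offDiag_average_mem_Icc {α : Type*} [DecidableEq α] {S : Finset α}
    (hS : 2 ≤ S.card) {f : α → α → ℝ} {B : ℝ}
    (hf : ∀ s ∈ S, ∀ s' ∈ S, s ≠ s' → f s s' ∈ Set.Icc 0 B) :
    1 / ((S.card : ℝ) * ((S.card : ℝ) - 1)) * ∑ s ∈ S, ∑ s' ∈ S.erase s, f s s' ∈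
      Set.Icc 0 B := by
  have hc : (2 : ℝ) ≤ S.card := by exact_mod_cast hS
  have hpos : 0 < (S.card : ℝ) * ((S.card : ℝ) - 1) := mul_pos (by linarith) (by linarith)
  have hf' : ∀ s ∈ S, ∀ s' ∈ S.erase s, f s s' ∈ Set.Icc 0 B := fun s hs s' hs' =>
    hf s hs s' (Finset.mem_of_mem_erase hs') (Finset.ne_of_mem_erase hs').symm
  constructor
  · exact mul_nonneg (by positivity)
      (Finset.sum_nonneg fun s hs => Finset.sum_nonneg fun s' hs' => (hf' s hs s' hs').1)
  · rw [one_div, inv_mul_le_iff₀ hpos]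
    calc ∑ s ∈ S, ∑ s' ∈ S.erase s, f s s' ≤ ∑ s ∈ S, ((S.card : ℝ) - 1) * B := by
          refine Finset.sum_le_sum fun s hs => ?_
          calc ∑ s' ∈ S.erase s, f s s' ≤ ∑ _s' ∈ S.erase s, B :=
                Finset.sum_le_sum fun s' hs' => (hf' s hs s' hs').2
            _ = ((S.card : ℝ) - 1) * B := by
                rw [Finset.sum_const, nsmul_eq_mul, Finset.cast_card_erase_of_mem hs]
      _ = (S.card : ℝ) * ((S.card : ℝ) - 1) * B := by simp [mul_assoc]


/-- Quantitative (ε > 0) form of the paper's Proposition 3 (OOD variance and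
diversity shift): under constant norm and low intra-sample similarity on the
source, the Gram matrix is invertible and the average Gaussian-process
posterior variance on the target equals
`(n_S/(2λ))·MMD² + λ_T − (n_S/(2λ))·β_T` up to an explicit `O(ε)` remainder. -/
theorem ood_variance_diversity_shift {X : Type*} [DecidableEq X]
    (S T : Finset X) (hS : 2 ≤ S.card) (hT : 2 ≤ T.card)
    (K : X → X → ℝ) (hsym : ∀ a b, K a b = K b a)
    (lam eps kap : ℝ) (hlam : 0 < lam) (heps : 0 ≤ eps) (hkap : 0 ≤ kap)
    (hdiag : ∀ s ∈ S, K s s = lam)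
    (hoff : ∀ s ∈ S, ∀ s' ∈ S, s ≠ s' → |K s s'| ≤ eps)
    (hcross : ∀ t ∈ T, ∀ s ∈ S, |K t s| ≤ kap)
    (hsmall : (S.card : ℝ) * eps < lam) :
    IsUnit (gramMatrix S K).det ∧
      |(T.card : ℝ)⁻¹ *
            (∑ t ∈ T, (K t t -
              ∑ i : {x // x ∈ S}, ∑ j : {x // x ∈ S},
                K t i.1 * (gramMatrix S K)⁻¹ i j * K t j.1)) -
          ((S.card : ℝ) / (2 * lam) *
              ((1 / ((S.card : ℝ) * ((S.card : ℝ) - 1))) *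
                  (∑ s ∈ S, ∑ s' ∈ S.erase s, K s s' ^ 2) +
                (1 / ((T.card : ℝ) * ((T.card : ℝ) - 1))) *
                  (∑ t ∈ T, ∑ t' ∈ T.erase t, K t t' ^ 2) -
                2 / ((S.card : ℝ) * (T.card : ℝ)) *
                  ∑ s ∈ S, ∑ t ∈ T, K s t ^ 2) +
            (T.card : ℝ)⁻¹ * (∑ t ∈ T, K t t) -
            (S.card : ℝ) / (2 * lam) *
              ((1 / ((T.card : ℝ) * ((T.card : ℝ) - 1))) *
                ∑ t ∈ T, ∑ t' ∈ T.erase t, K t t' ^ 2))| ≤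
        (S.card : ℝ) ^ 2 * kap ^ 2 * eps / (lam * (lam - (S.card : ℝ) * eps)) +
          (S.card : ℝ) / (2 * lam) * eps ^ 2 := by
  have hdiag' : ∀ i : {x // x ∈ S}, gramMatrix S K i i = lam := fun i => hdiag i.1 i.2
  have hoff' : ∀ i j : {x // x ∈ S}, i ≠ j → |gramMatrix S K i j| ≤ eps := fun i j hij =>
    hoff i.1 i.2 j.1 j.2 fun h => hij (Subtype.ext h)
  have hsmall' : (Fintype.card {x // x ∈ S} : ℝ) * eps < lam := by
    rwa [Fintype.card_coe]
  refine ⟨Matrix.isUnit_det_of_diag_eq_of_abs_offDiag_le hlam heps hdiag' hoff' hsmall', ?_⟩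
  have hSpos : (0 : ℝ) < S.card := by exact_mod_cast (by lia : 0 < S.card)
  have hTpos : (0 : ℝ) < T.card := by exact_mod_cast (by lia : 0 < T.card)
  have hquad : ∀ t ∈ T, |lam⁻¹ * ∑ s ∈ S, K s t ^ 2 -
      ∑ i : {x // x ∈ S}, ∑ j : {x // x ∈ S}, K t i.1 * (gramMatrix S K)⁻¹ i j * K t j.1| ≤
      (S.card : ℝ) ^ 2 * kap ^ 2 * eps / (lam * (lam - (S.card : ℝ) * eps)) := by
    intro t ht
    have h := Matrix.abs_quadForm_inv_sub_le hlam heps hkap hdiag' hoff' hsmall'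
      (v := fun i : {x // x ∈ S} => K t i.1) fun i => hcross t ht i.1 i.2
    rw [Fintype.card_coe, Finset.sum_coe_sort S fun s => K t s ^ 2] at h
    simpa only [hsym t] using h
  have havg := Finset.abs_inv_card_mul_sum_le (Finset.card_pos.mp (by lia)) hquad
  have hsource := Finset.offDiag_average_mem_Icc hS (f := fun s s' => K s s' ^ 2) (B := eps ^ 2)
    fun s hs s' hs' hne => ⟨sq_nonneg _, sq_le_sq' (abs_le.mp (hoff s hs s' hs' hne)).1
      (abs_le.mp (hoff s hs s' hs' hne)).2⟩
  have hscaled : |(S.card : ℝ) / (2 * lam) * (1 / ((S.card : ℝ) * ((S.card : ℝ) - 1)) *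
      ∑ s ∈ S, ∑ s' ∈ S.erase s, K s s' ^ 2)| ≤ (S.card : ℝ) / (2 * lam) * eps ^ 2 := by
    rw [abs_of_nonneg (mul_nonneg (by positivity) hsource.1)]
    exact mul_le_mul_of_nonneg_left hsource.2 (by positivity)
  refine le_trans (le_of_eq ?_) ((abs_sub _ _).trans (add_le_add havg hscaled))
  congr 1
  rw [Finset.sum_sub_distrib, Finset.sum_sub_distrib, ← Finset.mul_sum,
    Finset.sum_comm (s := S) (t := T)]
  have hcoef : (S.card : ℝ) / (2 * lam) * (2 / ((S.card : ℝ) * (T.card : ℝ))) =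
      (T.card : ℝ)⁻¹ * lam⁻¹ := by
    field_simp
  linear_combination (∑ t ∈ T, ∑ s ∈ S, K s t ^ 2) * hcoef
end
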